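/- There exist positive constants C₁, C₂ > 0 such that for all λ₁, λ₂ > 0 there exists a coupling of Poisson(λ₁) and Poisson(λ₂), i.e. a probability distribution of a pair (P₁, P₂) of random variables whose marginals are Poisson with parameters λ₁ and λ₂ respectively, satisfying Pr(P₁ = P₂) ≥ C₁·exp( −C₂·(λ₁ − λ₂)²/(λ₁ + λ₂) ). -/

import Mathlib

/-- The Poisson probability mass function with parameter `lam`:
`Pr(P = k) = e^{−lam}·lam^k / k!`. -/
noncomputable def poissonP (lam : ℝ) (k : ℕ) : ℝ :=
  Real.exp (-lam) * lam ^ k / (Nat.factorial k : ℝ)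

theorem hasSum_exp_neg_mul_pow_div_factorial (c x : ℝ) :
    HasSum (fun k : ℕ => Real.exp (-c) * x ^ k / (k.factorial : ℝ)) (Real.exp (x - c)) := by
  have h := (NormedSpace.expSeries_div_hasSum_exp x).mul_left (Real.exp (-c))
  rw [← Real.exp_eq_exp_ℝ, ← Real.exp_add, neg_add_eq_sub] at h
  simpa only [mul_div_assoc] using h

theorem hasSum_poissonP (lam : ℝ) : HasSum (poissonP lam) 1 := by
  have h := hasSum_exp_neg_mul_pow_div_factorial lam lam
  rwa [sub_self, Real.exp_zero] at h

theorem poissonP_nonneg {lam : ℝ} (h : 0 ≤ lam) (k : ℕ) : 0 ≤ poissonP lam k := by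
  unfold poissonP; positivity

/-- The maximal coupling: the diagonal carries the pointwise minimum of the two distributions. -/
theorem exists_coupling_diagonal_eq_min {p q : ℕ → ℝ} (hp0 : ∀ k, 0 ≤ p k) (hq0 : ∀ k, 0 ≤ q k)
    (hp : HasSum p 1) (hq : HasSum q 1) :
    ∃ μ : ℕ × ℕ → ℝ, (∀ x, 0 ≤ μ x) ∧ (∀ i, HasSum (fun j => μ (i, j)) (p i)) ∧
      (∀ j, HasSum (fun i => μ (i, j)) (q j)) ∧ ∀ i, μ (i, i) = min (p i) (q i) := by
  set m : ℕ → ℝ := fun k => min (p k) (q k) with hm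
  have hmp : ∀ k, 0 ≤ p k - m k := fun k => sub_nonneg.2 (min_le_left _ _)
  have hmq : ∀ k, 0 ≤ q k - m k := fun k => sub_nonneg.2 (min_le_right _ _)
  have hms : Summable m :=
    hp.summable.of_nonneg_of_le (fun k => le_min (hp0 k) (hq0 k)) (fun k => min_le_left _ _)
  obtain ⟨s, hs⟩ := hms
  have hps := hp.sub hs
  have hqs := hq.sub hs
  have hs1 : 0 ≤ 1 - s := hps.nonneg hmp
  have cancel : ∀ {f : ℕ → ℝ}, (∀ k, 0 ≤ f k) → HasSum f (1 - s) →
      ∀ k, f k * (1 - s) / (1 - s) = f k := by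
    intro f hf hfs k
    rcases eq_or_ne (1 - s) 0 with h | h
    · rw [h] at hfs
      simp [congrFun ((hasSum_zero_iff_of_nonneg hf).1 hfs) k]
    · exact mul_div_cancel_right₀ _ h
  have hdiag : ∀ i j, (if j = i then m i else 0) = if i = j then m j else 0 := by
    intro i j
    by_cases h : i = j
    · simp [h]
    · simp [h, Ne.symm h]
  refine ⟨fun x => (if x.1 = x.2 then m x.2 else 0) +
      (p x.1 - m x.1) * (q x.2 - m x.2) / (1 - s), ?_, ?_, ?_, ?_⟩
  · intro x
    refine add_nonneg ?_ (div_nonneg (mul_nonneg (hmp _) (hmq _)) hs1)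
    split_ifs
    exacts [le_min (hp0 _) (hq0 _), le_rfl]
  · intro i
    have h := (hasSum_ite_eq i (m i)).add ((hqs.mul_left (p i - m i)).div_const (1 - s))
    rw [cancel hmp hps i, add_sub_cancel] at h
    simpa only [hdiag] using h
  · intro j
    have h := (hasSum_ite_eq j (m j)).add ((hps.mul_right (q j - m j)).div_const (1 - s))
    rw [mul_comm (1 - s), cancel hmq hqs j, add_sub_cancel] at h
    exact h
  · intro i
    have h : (p i - m i) * (q i - m i) = 0 := by
      rcases le_total (p i) (q i) with h | h <;> simp [hm, h]
    simp only [h, zero_div, add_zero, if_true]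
    rfl

/-- The overlap of two distributions is at least half the square of their Bhattacharyya
coefficient. -/
theorem sq_div_two_le_tsum_min {p q r : ℕ → ℝ} {b : ℝ} (hp0 : ∀ k, 0 ≤ p k) (hq0 : ∀ k, 0 ≤ q k)
    (hp : HasSum p 1) (hq : HasSum q 1) (hr : HasSum r b) (hrpq : ∀ k, r k ^ 2 = p k * q k) :
    b ^ 2 / 2 ≤ ∑' k, min (p k) (q k) := by
  have hms : Summable fun k => min (p k) (q k) :=
    hp.summable.of_nonneg_of_le (fun k => le_min (hp0 k) (hq0 k)) (fun k => min_le_left _ _)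
  have hL := (hr.mul_left b).sub ((hp.add hq).mul_left (b ^ 2 / 4))
  have key : ∀ k, b * r k - b ^ 2 / 4 * (p k + q k) ≤ min (p k) (q k) := by
    intro k
    have aux : ∀ {x y : ℝ}, 0 ≤ x → 0 ≤ y → r k ^ 2 = x * y →
        b * r k - b ^ 2 / 4 * (x + y) ≤ x := by
      intro x y hx hy h
      have hsq : (b * r k) ^ 2 ≤ (x + b ^ 2 / 4 * y) ^ 2 := by
        have : (b * r k) ^ 2 = b ^ 2 * (x * y) := by rw [mul_pow, h]
        nlinarith [sq_nonneg (x - b ^ 2 / 4 * y)]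
      have := abs_le_of_sq_le_sq' hsq (by positivity)
      nlinarith [this.2, mul_nonneg (sq_nonneg b) hx]
    refine le_min (aux (hp0 k) (hq0 k) (hrpq k)) ?_
    rw [add_comm (p k)]
    exact aux (hq0 k) (hp0 k) (by rw [hrpq, mul_comm])
  have := hasSum_le key hL hms.hasSum
  linarith

theorem sq_sqrt_sub_sqrt_le {a b : ℝ} (ha : 0 < a) (hb : 0 < b) :
    (√a - √b) ^ 2 ≤ (a - b) ^ 2 / (a + b) := by
  rw [le_div_iff₀ (by positivity)]
  have h : (a - b) ^ 2 = (√a - √b) ^ 2 * (√a + √b) ^ 2 := by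
    rw [← mul_pow, mul_comm, ← sq_sub_sq, Real.sq_sqrt ha.le, Real.sq_sqrt hb.le]
  rw [h]
  refine mul_le_mul_of_nonneg_left ?_ (sq_nonneg _)
  nlinarith [Real.sq_sqrt ha.le, Real.sq_sqrt hb.le, Real.sqrt_nonneg a, Real.sqrt_nonneg b,
    mul_nonneg (Real.sqrt_nonneg a) (Real.sqrt_nonneg b)]

theorem half_exp_le_tsum_min_poissonP {a b : ℝ} (ha : 0 < a) (hb : 0 < b) :
    1 / 2 * Real.exp (-1 * (a - b) ^ 2 / (a + b)) ≤ ∑' k, min (poissonP a k) (poissonP b k) := by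
  have hrpq : ∀ k : ℕ, (Real.exp (-((a + b) / 2)) * (√a * √b) ^ k / (k.factorial : ℝ)) ^ 2
      = poissonP a k * poissonP b k := by
    intro k
    have hexp : Real.exp (-((a + b) / 2)) ^ 2 = Real.exp (-a) * Real.exp (-b) := by
      rw [← Real.exp_nat_mul, ← Real.exp_add]
      congr 1
      push_cast
      ring
    have hpow : ((√a * √b) ^ k) ^ 2 = a ^ k * b ^ k := by
      rw [← pow_mul, mul_comm k, pow_mul, mul_pow, Real.sq_sqrt ha.le, Real.sq_sqrt hb.le, mul_pow]
    rw [div_pow, mul_pow, hexp, hpow, poissonP, poissonP]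
    ring
  refine le_trans ?_ (sq_div_two_le_tsum_min (poissonP_nonneg ha.le) (poissonP_nonneg hb.le)
    (hasSum_poissonP a) (hasSum_poissonP b)
    (hasSum_exp_neg_mul_pow_div_factorial ((a + b) / 2) (√a * √b)) hrpq)
  rw [← Real.exp_nat_mul, one_div_mul_eq_div]
  gcongr
  have h := sq_sqrt_sub_sqrt_le ha hb
  rw [sub_sq, Real.sq_sqrt ha.le, Real.sq_sqrt hb.le] at h
  rw [neg_one_mul, neg_div]
  push_cast
  linarith

/-- **Corollary (coupling of two Poisson random variables).** There exist constants
`C₁, C₂ > 0` such that for all `λ₁, λ₂ > 0` there is a coupling `μ` of `Poisson(λ₁)` and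
`Poisson(λ₂)` (a joint distribution on `ℕ × ℕ` with the respective marginals) with
`Pr(P₁ = P₂) ≥ C₁·exp(−C₂·(λ₁ − λ₂)²/(λ₁ + λ₂))`. -/
theorem poisson_coupling_diagonal :
    ∃ C₁ C₂ : ℝ, 0 < C₁ ∧ 0 < C₂ ∧
      ∀ lam₁ lam₂ : ℝ, 0 < lam₁ → 0 < lam₂ →
        ∃ μ : ℕ × ℕ → ℝ,
          (∀ p, 0 ≤ μ p) ∧
          (∀ i, HasSum (fun j => μ (i, j)) (poissonP lam₁ i)) ∧
          (∀ j, HasSum (fun i => μ (i, j)) (poissonP lam₂ j)) ∧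
          C₁ * Real.exp (-C₂ * (lam₁ - lam₂) ^ 2 / (lam₁ + lam₂))
            ≤ ∑' i : ℕ, μ (i, i) := by
  refine ⟨1 / 2, 1, by norm_num, one_pos, fun a b ha hb => ?_⟩
  obtain ⟨μ, h0, h1, h2, hμ⟩ := exists_coupling_diagonal_eq_min (poissonP_nonneg ha.le)
    (poissonP_nonneg hb.le) (hasSum_poissonP a) (hasSum_poissonP b)
  refine ⟨μ, h0, h1, h2, ?_⟩
  simp only [hμ]
  exact half_exp_le_tsum_min_poissonP ha hb
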